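/- arXiv:1807.09894 — 4 statements merged into one kernel-verified Lean document; each statement's English description precedes it below -/
import Mathlib

section
/- Under these hypotheses, for every γ ∈ X' and δ ∈ M' there exists a unique pair (w, π) ∈ X × M such that A(w, v) + B(v, π) = γ(v) for all v ∈ X and B(w, q) = δ(q) for all q ∈ M. -/
open InnerProductSpace in
/-- The **Lax–Milgram theorem**, phrased with continuous linear functionals. -/
theorem IsCoercive.existsUnique_forall_apply_eq
    {V : Type*} [NormedAddCommGroup V] [InnerProductSpace ℝ V] [CompleteSpace V]
    {S : V →L[ℝ] V →L[ℝ] ℝ} (hS : IsCoercive S) (f : V →L[ℝ] ℝ) :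
    ∃! v : V, ∀ w : V, S v w = f w := by
  refine ⟨hS.continuousLinearEquivOfBilin.symm ((toDual ℝ V).symm f), fun w => ?_, fun v hv => ?_⟩
  · rw [← hS.continuousLinearEquivOfBilin_apply]
    simp
  · rw [ContinuousLinearEquiv.eq_symm_apply]
    refine ext_inner_right ℝ fun w => ?_
    rw [hS.continuousLinearEquivOfBilin_apply, hv, toDual_symm_apply]

/-- A coercive bilinear form on a Hilbert space identifies the space with its dual. -/
noncomputable def IsCoercive.equivDual
    {V : Type*} [NormedAddCommGroup V] [InnerProductSpace ℝ V] [CompleteSpace V]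
    {S : V →L[ℝ] V →L[ℝ] ℝ} (hS : IsCoercive S) : V ≃L[ℝ] (V →L[ℝ] ℝ) :=
  ContinuousLinearEquiv.ofBijective S
    (LinearMap.ker_eq_bot.2 fun v _ h =>
      (hS.existsUnique_forall_apply_eq (S v)).unique (fun _ => rfl) fun w =>
        (DFunLike.congr_fun h w).symm)
    (LinearMap.range_eq_top.2 fun f =>
      (hS.existsUnique_forall_apply_eq f).exists.imp fun _ hv => ContinuousLinearMap.ext hv)

theorem IsCoercive.equivDual_apply
    {V : Type*} [NormedAddCommGroup V] [InnerProductSpace ℝ V] [CompleteSpace V]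
    {S : V →L[ℝ] V →L[ℝ] ℝ} (hS : IsCoercive S) (v : V) : hS.equivDual v = S v :=
  rfl

/-- The supremum in the inf-sup condition is at most the dual norm. -/
theorem ContinuousLinearMap.iSup_apply_div_norm_le_norm
    {X : Type*} [NormedAddCommGroup X] [NormedSpace ℝ X] (f : X →L[ℝ] ℝ) :
    ⨆ w : {w : X // w ≠ 0}, f w / ‖(w : X)‖ ≤ ‖f‖ :=
  Real.iSup_le (fun w => div_le_of_le_mul₀ (norm_nonneg _) (norm_nonneg _)
    ((le_abs_self _).trans (f.le_opNorm w))) (norm_nonneg _)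

/-- The Schur complement `(π, q) ↦ B (A⁻¹ (B · π)) q` of a coercive form `A` with respect to a form
`B` that is bounded below in its second variable is coercive. -/
theorem isCoercive_schurComplement
    {X M : Type*} [NormedAddCommGroup X] [NormedSpace ℝ X]
    [NormedAddCommGroup M] [NormedSpace ℝ M]
    {A : X →L[ℝ] X →L[ℝ] ℝ} {B : X →L[ℝ] M →L[ℝ] ℝ} {α β : ℝ} (hα : 0 < α) (hβ : 0 < β)
    (hA : ∀ w : X, α * ‖w‖ ^ 2 ≤ A w w) (hB : ∀ π : M, β * ‖π‖ ≤ ‖B.flip π‖)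
    {R : M →L[ℝ] X} (hR : ∀ (π : M) (v : X), A (R π) v = B v π) :
    IsCoercive (B ∘L R) := by
  have hK : 0 < ‖A‖ + 1 := by positivity
  refine ⟨α * (β / (‖A‖ + 1)) ^ 2, by positivity, fun π => ?_⟩
  have hflip : B.flip π = A (R π) := by
    ext v
    simp [hR]
  have hbound : β / (‖A‖ + 1) * ‖π‖ ≤ ‖R π‖ := by
    rw [div_mul_eq_mul_div, div_le_iff₀ hK]
    calc β * ‖π‖ ≤ ‖A (R π)‖ := hflip ▸ hB π
      _ ≤ ‖A‖ * ‖R π‖ := A.le_opNorm _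
      _ ≤ ‖R π‖ * (‖A‖ + 1) := by nlinarith [norm_nonneg (R π)]
  calc α * (β / (‖A‖ + 1)) ^ 2 * ‖π‖ * ‖π‖ = α * (β / (‖A‖ + 1) * ‖π‖) ^ 2 := by ring
    _ ≤ α * ‖R π‖ ^ 2 := by gcongr
    _ ≤ A (R π) (R π) := hA _
    _ = (B ∘L R) π π := by simp [hR]

/-- Saddle-point problem (Babuška–Brezzi): existence and uniqueness.
`X` and `M` are real Hilbert spaces, `A` and `B` continuous bilinear forms,
`A` coercive with constant `α > 0`, `B` satisfying the inf-sup condition with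
constant `β > 0`.  Then for every `γ ∈ X'` and `δ ∈ M'` there is a unique pair
`(w, π)` with `A(w,v) + B(v,π) = γ(v)` for all `v` and `B(w,q) = δ(q)` for all `q`. -/
theorem stmt_0
    {X M : Type*} [NormedAddCommGroup X] [InnerProductSpace ℝ X] [CompleteSpace X]
    [NormedAddCommGroup M] [InnerProductSpace ℝ M] [CompleteSpace M]
    (A : X →L[ℝ] X →L[ℝ] ℝ) (B : X →L[ℝ] M →L[ℝ] ℝ)
    (α : ℝ) (hα : 0 < α) (hcoer : ∀ w : X, α * ‖w‖ ^ 2 ≤ A w w)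
    (β : ℝ) (hβ : 0 < β)
    (hinfsup : ∀ π : M, β * ‖π‖ ≤ ⨆ w : {w : X // w ≠ 0}, B w π / ‖(w : X)‖)
    (γ : X →L[ℝ] ℝ) (δ : M →L[ℝ] ℝ) :
    ∃! wπ : X × M, (∀ v : X, A wπ.1 v + B v wπ.2 = γ v) ∧ (∀ q : M, B wπ.1 q = δ q) := by
  have hcA : IsCoercive A := ⟨α, hα, fun w => by simpa [pow_two, mul_assoc] using hcoer w⟩
  obtain ⟨R, hR⟩ : ∃ R : M →L[ℝ] X, ∀ (π : M) (v : X), A (R π) v = B v π :=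
    ⟨hcA.equivDual.symm ∘L B.flip, fun π v => by
      rw [← hcA.equivDual_apply]
      simp⟩
  have hcS : IsCoercive (B ∘L R) := isCoercive_schurComplement hα hβ hcoer
    (fun π => (hinfsup π).trans (B.flip π).iSup_apply_div_norm_le_norm) hR
  obtain ⟨u, hu, hu_unique⟩ := hcA.existsUnique_forall_apply_eq γ
  obtain ⟨π, hπ, hπ_unique⟩ := hcS.existsUnique_forall_apply_eq (B u - δ)
  refine ⟨(u - R π, π), ⟨fun v => by simp [hu, hR], fun q => ?_⟩, ?_⟩
  · have := hπ q
    simp only [ContinuousLinearMap.comp_apply, sub_apply] at this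
    simp [this]
  · rintro ⟨w, p⟩ ⟨h₁, h₂⟩
    have hw : w + R p = u := hu_unique _ fun v => by simpa [hR] using h₁ v
    obtain rfl : p = π := hπ_unique _ fun q => by simp [← hw, h₂]
    simp [← hw]
end

section
/- If there is a constant c > 0 such that ‖x‖_X ≤ c(‖Ax‖_Y + ‖Tx‖_Z) for all x ∈ X, then there exists a constant C > 0 such that ‖x‖_X ≤ C‖Ax‖_Y for all x ∈ X (the Petree–Tartar lemma). -/
/-- Petree–Tartar lemma: `X, Y, Z` Banach spaces, `A : X → Y` injective continuous
linear, `T : X → Z` compact linear (maps bounded sets to relatively compact sets).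
If `‖x‖ ≤ c (‖Ax‖ + ‖Tx‖)` for all `x` with some `c > 0`, then there is `C > 0`
with `‖x‖ ≤ C ‖Ax‖` for all `x`. -/
theorem stmt_4
    {X Y Z : Type*} [NormedAddCommGroup X] [NormedSpace ℝ X] [CompleteSpace X]
    [NormedAddCommGroup Y] [NormedSpace ℝ Y] [CompleteSpace Y]
    [NormedAddCommGroup Z] [NormedSpace ℝ Z] [CompleteSpace Z]
    (A : X →L[ℝ] Y) (hA : Function.Injective A)
    (T : X →ₗ[ℝ] Z)
    (hT : ∀ s : Set X, Bornology.IsBounded s → IsCompact (closure (T '' s)))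
    (c : ℝ) (hc : 0 < c) (hbound : ∀ x : X, ‖x‖ ≤ c * (‖A x‖ + ‖T x‖)) :
    ∃ C > (0 : ℝ), ∀ x : X, ‖x‖ ≤ C * ‖A x‖ := by
  by_contra! hC
  have hseq : ∀ n : ℕ, ∃ u : X, ‖u‖ = 1 ∧ ‖A u‖ ≤ 1 / ((n : ℝ) + 1) := by
    intro n
    have hn : (0 : ℝ) < n + 1 := by positivity
    obtain ⟨x, hx⟩ := hC (n + 1) hn
    have hx0 : 0 < ‖x‖ := lt_of_le_of_lt (by positivity) hx
    refine ⟨‖x‖⁻¹ • x, ?_, ?_⟩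
    · rw [norm_smul, norm_inv, norm_norm, inv_mul_cancel₀ hx0.ne']
    · rw [map_smul, norm_smul, norm_inv, norm_norm, inv_mul_eq_div, div_le_div_iff₀ hx0 hn]
      linarith
  choose u hu hAu using hseq
  have hAu0 : Filter.Tendsto (fun n => A (u n)) Filter.atTop (nhds 0) :=
    squeeze_zero_norm hAu tendsto_one_div_add_atTop_nhds_zero_nat
  obtain ⟨z, -, φ, hφ, hz⟩ := (hT _ Metric.isBounded_closedBall).tendsto_subseq
    (fun n => subset_closure (Set.mem_image_of_mem T
      (mem_closedBall_zero_iff.mpr (hu n).le)))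
  have hAφ := hAu0.comp hφ.tendsto_atTop
  have hcauchy : CauchySeq (u ∘ φ) := by
    rw [Metric.cauchySeq_iff]
    intro ε hε
    have hδ : 0 < ε / (2 * c) := by positivity
    obtain ⟨N, hN⟩ := Metric.cauchySeq_iff.mp hAφ.cauchySeq _ hδ
    obtain ⟨M, hM⟩ := Metric.cauchySeq_iff.mp hz.cauchySeq _ hδ
    refine ⟨max N M, fun m hm n hn => ?_⟩
    have hA' := hN m (le_of_max_le_left hm) n (le_of_max_le_left hn)
    have hT' := hM m (le_of_max_le_right hm) n (le_of_max_le_right hn)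
    simp only [Function.comp_apply, dist_eq_norm, ← map_sub] at hA' hT' ⊢
    calc ‖u (φ m) - u (φ n)‖
        ≤ c * (‖A (u (φ m) - u (φ n))‖ + ‖T (u (φ m) - u (φ n))‖) := hbound _
      _ < c * (ε / (2 * c) + ε / (2 * c)) := by gcongr
      _ = ε := by field_simp; ring
  obtain ⟨x, hx⟩ := cauchySeq_tendsto_of_complete hcauchy
  have hAx : A x = 0 := tendsto_nhds_unique ((A.continuous.tendsto x).comp hx) hAφ
  have hx1 : ‖x‖ = 1 :=
    tendsto_nhds_unique hx.norm (by simp [Function.comp_apply, hu])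
  have hx0 : x = 0 := hA (by rw [hAx, map_zero])
  simp [hx0] at hx1
end

section
/- For every linear functional H : V → ℝ there exists a unique u ∈ V with M(u, v) = H(v) for all v ∈ V, and this solution satisfies ‖u‖ ≤ (1/C) · sup over v ∈ V \ {0} of H(v)/‖v‖. -/
/-- Well-posedness from a discrete inf-sup condition on a nontrivial
finite-dimensional real normed space: for every linear functional `H` there is a
unique `u` with `M(u, v) = H(v)` for all `v`, and this solution satisfies
`‖u‖ ≤ (1/C) · sup_{v ≠ 0} H(v)/‖v‖`. -/
theorem stmt_5
    {V : Type*} [NormedAddCommGroup V] [NormedSpace ℝ V]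
    [FiniteDimensional ℝ V] [Nontrivial V]
    (M : V →ₗ[ℝ] V →ₗ[ℝ] ℝ) (C : ℝ) (hC : 0 < C)
    (hinfsup : ∀ u : V, C * ‖u‖ ≤ ⨆ v : {v : V // v ≠ 0}, M u v / ‖(v : V)‖)
    (H : V →ₗ[ℝ] ℝ) :
    (∃! u : V, ∀ v : V, M u v = H v) ∧
    (∀ u : V, (∀ v : V, M u v = H v) →
      ‖u‖ ≤ (1 / C) * ⨆ v : {v : V // v ≠ 0}, H v / ‖(v : V)‖) := by
  have hinj : Function.Injective M := by
    refine (injective_iff_map_eq_zero M).2 fun u hu => ?_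
    have h := hinfsup u
    simp only [hu, LinearMap.zero_apply, zero_div, Real.iSup_const_zero] at h
    exact norm_le_zero_iff.1 (nonpos_of_mul_nonpos_right h hC)
  have hsurj : Function.Surjective M :=
    (LinearMap.injective_iff_surjective_of_finrank_eq_finrank
      (Subspace.dual_finrank_eq (K := ℝ) (V := V)).symm).1 hinj
  refine ⟨?_, fun u hu => ?_⟩
  · obtain ⟨u, hu⟩ := hsurj H
    refine ⟨u, fun v => by rw [hu], fun w hw => hinj ?_⟩
    rw [hu]
    exact LinearMap.ext hw
  · have h := hinfsup u
    simp only [hu] at h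
    rw [one_div, ← div_eq_inv_mul, le_div_iff₀' hC]
    exact h
end

section
/- The integral of p over B with respect to two-dimensional Lebesgue measure is zero, and the integral of p over [0,1]² \ B with respect to two-dimensional Lebesgue measure is also zero. -/
open MeasureTheory

/-- A function that is odd under a measure-preserving map has integral zero over every set
invariant under that map. -/
theorem MeasureTheory.MeasurePreserving.setIntegral_eq_zero_of_odd {α : Type*} [MeasurableSpace α]
    {μ : Measure α} {T : α → α} (hT : MeasurePreserving T μ μ) (hTe : MeasurableEmbedding T)
    {f : α → ℝ} (hf : ∀ x, f (T x) = -f x) {s : Set α} (hs : T ⁻¹' s = s) :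
    ∫ x in s, f x ∂μ = 0 := by
  have h := hT.setIntegral_preimage_emb hTe f s
  simp only [hs, hf, integral_neg] at h
  linarith

/-- The reflection of the plane in the line `y = 1/2`. -/
noncomputable def reflectSnd : EuclideanSpace ℝ (Fin 2) ≃ᵢ EuclideanSpace ℝ (Fin 2) :=
  (LinearIsometryEquiv.piLpCongrRight 2
    (fun i : Fin 2 => if i = 0 then LinearIsometryEquiv.refl ℝ ℝ
      else LinearIsometryEquiv.neg ℝ)).toIsometryEquiv.trans
    (IsometryEquiv.addRight (EuclideanSpace.single 1 1))

theorem reflectSnd_apply_zero (x : EuclideanSpace ℝ (Fin 2)) : reflectSnd x 0 = x 0 := by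
  simp [reflectSnd]

theorem reflectSnd_apply_one (x : EuclideanSpace ℝ (Fin 2)) : reflectSnd x 1 = 1 - x 1 := by
  simp [reflectSnd]
  ring

theorem measurePreserving_reflectSnd : MeasurePreserving reflectSnd :=
  (measurePreserving_add_right volume (EuclideanSpace.single 1 1)).comp
    (LinearIsometryEquiv.measurePreserving _)

/-- For `p(x, y) = (y − 1/2) cos(2πx) + (x − 1/2) sin(2πy)` and `B` the closed
Euclidean disc of centre `(1/2, 1/2)` and radius `0 < R ≤ 1/2` (so `B ⊆ [0,1]²`),
the integral of `p` over `B` with respect to two-dimensional Lebesgue measure is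
zero, and so is the integral of `p` over `[0,1]² \ B`. -/
theorem stmt_12
    (R : ℝ) (hR0 : 0 < R) (hR : R ≤ 1 / 2)
    (p : EuclideanSpace ℝ (Fin 2) → ℝ)
    (hp : ∀ x : EuclideanSpace ℝ (Fin 2),
      p x = (x 1 - 1 / 2) * Real.cos (2 * Real.pi * x 0)
            + (x 0 - 1 / 2) * Real.sin (2 * Real.pi * x 1))
    (c : EuclideanSpace ℝ (Fin 2)) (hc0 : c 0 = 1 / 2) (hc1 : c 1 = 1 / 2)
    (B : Set (EuclideanSpace ℝ (Fin 2))) (hB : B = Metric.closedBall c R)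
    (Q : Set (EuclideanSpace ℝ (Fin 2)))
    (hQ : Q = {x : EuclideanSpace ℝ (Fin 2) |
      x 0 ∈ Set.Icc (0 : ℝ) 1 ∧ x 1 ∈ Set.Icc (0 : ℝ) 1}) :
    (∫ x in B, p x) = 0 ∧ (∫ x in Q \ B, p x) = 0 := by
  have hmain : ∀ s : Set (EuclideanSpace ℝ (Fin 2)), reflectSnd ⁻¹' s = s →
      ∫ x in s, p x = 0 := fun s hs =>
    measurePreserving_reflectSnd.setIntegral_eq_zero_of_odd
      reflectSnd.toHomeomorph.measurableEmbedding (fun x => by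
        rw [hp, hp, reflectSnd_apply_zero, reflectSnd_apply_one, mul_sub, mul_one,
          Real.sin_two_pi_sub]
        ring) hs
  have hc : reflectSnd c = c := by
    ext i
    fin_cases i
    · exact reflectSnd_apply_zero c
    · exact (reflectSnd_apply_one c).trans (show 1 - c 1 = c 1 by linarith)
  have hBinv : reflectSnd ⁻¹' B = B := by
    ext x
    have h := reflectSnd.dist_eq x c
    rw [hc] at h
    rw [hB, Set.mem_preimage, Metric.mem_closedBall, Metric.mem_closedBall, h]
  have hQinv : reflectSnd ⁻¹' Q = Q := by
    ext x
    simp only [hQ, Set.mem_preimage, Set.mem_ofPred_eq, reflectSnd_apply_zero,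
      reflectSnd_apply_one, Set.mem_Icc]
    constructor <;> rintro ⟨h, h0, h1⟩ <;> exact ⟨h, by linarith, by linarith⟩
  exact ⟨hmain B hBinv, hmain (Q \ B) (by rw [Set.preimage_sdiff, hBinv, hQinv])⟩
end
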